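/- arXiv:0910.2096 — 6 statements merged into one kernel-verified Lean document; each statement's English description precedes it below -/
import Mathlib

section
/- Let u : ℂ → ℝ be smooth and for λ ∈ ℂ\{0} define the 2×2 matrix-valued functions A_λ = (1/2)[[∂u, i λ⁻¹ e^{u}], [i e^{−u}, −∂u]] and B_λ = (1/2)[[−∂̄u, i e^{−u}], [i λ e^{u}, ∂̄u]]. Then the zero-curvature (Maurer–Cartan) equation ∂B_λ − ∂̄A_λ + A_λ B_λ − B_λ A_λ = 0 holds identically on ℂ for every λ ∈ ℂ\{0} if and only if u solves the sinh-Gordon equation ∂∂̄u + (1/2) sinh(2u) = 0. -/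
noncomputable section

open Complex Matrix

/-- Wirtinger derivative `∂f = (1/2)(f_x - i f_y)`. -/
def wd (f : ℂ → ℂ) (z : ℂ) : ℂ :=
  (fderiv ℝ f z 1 - Complex.I * fderiv ℝ f z Complex.I) / 2

/-- Conjugate Wirtinger derivative `∂̄f = (1/2)(f_x + i f_y)`. -/
def wdb (f : ℂ → ℂ) (z : ℂ) : ℂ :=
  (fderiv ℝ f z 1 + Complex.I * fderiv ℝ f z Complex.I) / 2

/-- Complexification of a real-valued function. -/
def cx (u : ℂ → ℝ) : ℂ → ℂ := fun z => (u z : ℂ)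

/-- Entrywise Wirtinger derivative of a matrix-valued function. -/
def mwd (F : ℂ → Matrix (Fin 2) (Fin 2) ℂ) (z : ℂ) : Matrix (Fin 2) (Fin 2) ℂ :=
  Matrix.of fun i j => wd (fun w => F w i j) z

/-- Entrywise conjugate Wirtinger derivative of a matrix-valued function. -/
def mwdb (F : ℂ → Matrix (Fin 2) (Fin 2) ℂ) (z : ℂ) : Matrix (Fin 2) (Fin 2) ℂ :=
  Matrix.of fun i j => wdb (fun w => F w i j) z

/-- Entrywise Wirtinger derivative of a vector-valued function. -/
def vwd (v : ℂ → Fin 2 → ℂ) (z : ℂ) : Fin 2 → ℂ := fun i => wd (fun w => v w i) z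

/-- Entrywise conjugate Wirtinger derivative of a vector-valued function. -/
def vwdb (v : ℂ → Fin 2 → ℂ) (z : ℂ) : Fin 2 → ℂ := fun i => wdb (fun w => v w i) z

/-- `u` solves the sinh-Gordon equation `∂∂̄u + (1/2) sinh (2u) = 0`. -/
def SinhGordon (u : ℂ → ℝ) : Prop :=
  ∀ z, wd (wdb (cx u)) z + (1/2) * Complex.sinh (2 * (u z : ℂ)) = 0

/-- `(ψ₁, ψ₂)` solves the system `(Ψ_λ)`. -/
def SolPsi (u : ℂ → ℝ) (lam : ℂ) (p1 p2 : ℂ → ℂ) : Prop :=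
  ContDiff ℝ (⊤ : ℕ∞) p1 ∧ ContDiff ℝ (⊤ : ℕ∞) p2 ∧
  (∀ z, wd p1 z = (1/2) * (wd (cx u) z * p1 z
      + Complex.I * Complex.exp (-(u z : ℂ)) * p2 z)) ∧
  (∀ z, wd p2 z = (1/2) * (Complex.I * lam⁻¹ * Complex.exp ((u z : ℂ)) * p1 z
      - wd (cx u) z * p2 z)) ∧
  (∀ z, wdb p1 z = (1/2) * (-(wdb (cx u) z) * p1 z
      + Complex.I * lam * Complex.exp ((u z : ℂ)) * p2 z)) ∧
  (∀ z, wdb p2 z = (1/2) * (Complex.I * Complex.exp (-(u z : ℂ)) * p1 z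
      + wdb (cx u) z * p2 z))

/-- `(φ₁, φ₂)` solves the system `(Φ_λ)`. -/
def SolPhi (u : ℂ → ℝ) (lam : ℂ) (f1 f2 : ℂ → ℂ) : Prop :=
  ContDiff ℝ (⊤ : ℕ∞) f1 ∧ ContDiff ℝ (⊤ : ℕ∞) f2 ∧
  (∀ z, wd f1 z = -(1/2) * (wd (cx u) z * f1 z
      + Complex.I * lam⁻¹ * Complex.exp ((u z : ℂ)) * f2 z)) ∧
  (∀ z, wd f2 z = -(1/2) * (Complex.I * Complex.exp (-(u z : ℂ)) * f1 z
      - wd (cx u) z * f2 z)) ∧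
  (∀ z, wdb f1 z = -(1/2) * (-(wdb (cx u) z) * f1 z
      + Complex.I * Complex.exp (-(u z : ℂ)) * f2 z)) ∧
  (∀ z, wdb f2 z = -(1/2) * (Complex.I * lam * Complex.exp ((u z : ℂ)) * f1 z
      + wdb (cx u) z * f2 z))

/-- The matrix `A_λ = (1/2) [[∂u, iλ⁻¹e^u], [ie^{-u}, -∂u]]`. -/
def matA (u : ℂ → ℝ) (lam : ℂ) (z : ℂ) : Matrix (Fin 2) (Fin 2) ℂ :=
  ((1:ℂ)/2) • !![wd (cx u) z, Complex.I * lam⁻¹ * Complex.exp ((u z : ℂ));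
    Complex.I * Complex.exp (-(u z : ℂ)), -(wd (cx u) z)]

/-- The matrix `B_λ = (1/2) [[-∂̄u, ie^{-u}], [iλe^u, ∂̄u]]`. -/
def matB (u : ℂ → ℝ) (lam : ℂ) (z : ℂ) : Matrix (Fin 2) (Fin 2) ℂ :=
  ((1:ℂ)/2) • !![-(wdb (cx u) z), Complex.I * Complex.exp (-(u z : ℂ));
    Complex.I * lam * Complex.exp ((u z : ℂ)), wdb (cx u) z]

theorem fderiv_fun_const_mul_apply {f : ℂ → ℂ} {z : ℂ} (c : ℂ) (hf : DifferentiableAt ℝ f z) (v : ℂ) :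
    fderiv ℝ (fun w => c * f w) z v = c * fderiv ℝ f z v := by
  rw [(hf.hasFDerivAt.const_mul c).fderiv]
  simp

theorem wd_const_mul {f : ℂ → ℂ} {z : ℂ} (c : ℂ) (hf : DifferentiableAt ℝ f z) :
    wd (fun w => c * f w) z = c * wd f z := by
  simp only [wd, fderiv_fun_const_mul_apply c hf]
  ring

theorem wdb_const_mul {f : ℂ → ℂ} {z : ℂ} (c : ℂ) (hf : DifferentiableAt ℝ f z) :
    wdb (fun w => c * f w) z = c * wdb f z := by
  simp only [wdb, fderiv_fun_const_mul_apply c hf]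
  ring

theorem fderiv_exp_const_mul_apply {f : ℂ → ℂ} {z : ℂ} (c : ℂ) (hf : DifferentiableAt ℝ f z)
    (v : ℂ) :
    fderiv ℝ (fun w => Complex.exp (c * f w)) z v
      = c * Complex.exp (c * f z) * fderiv ℝ f z v := by
  rw [((hf.hasFDerivAt.const_mul c).cexp).fderiv]
  simp
  ring

theorem wd_exp_const_mul {f : ℂ → ℂ} {z : ℂ} (c : ℂ) (hf : DifferentiableAt ℝ f z) :
    wd (fun w => Complex.exp (c * f w)) z = c * Complex.exp (c * f z) * wd f z := by
  simp only [wd, fderiv_exp_const_mul_apply c hf]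
  ring

theorem wdb_exp_const_mul {f : ℂ → ℂ} {z : ℂ} (c : ℂ) (hf : DifferentiableAt ℝ f z) :
    wdb (fun w => Complex.exp (c * f w)) z = c * Complex.exp (c * f z) * wdb f z := by
  simp only [wdb, fderiv_exp_const_mul_apply c hf]
  ring

theorem hasFDerivAt_fderiv_apply {f : ℂ → ℂ} (hf : ContDiff ℝ 2 f) (z v : ℂ) :
    HasFDerivAt (fun w => fderiv ℝ f w v) ((fderiv ℝ (fderiv ℝ f) z).flip v) z := by
  have h : DifferentiableAt ℝ (fderiv ℝ f) z :=
    (hf.fderiv_right (m := 1) (by norm_num)).differentiable (by norm_num) z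
  simpa using h.hasFDerivAt.clm_apply (hasFDerivAt_const v z)

theorem hasFDerivAt_wd {f : ℂ → ℂ} (hf : ContDiff ℝ 2 f) (z : ℂ) :
    HasFDerivAt (wd f) ((2⁻¹ : ℂ) • ((fderiv ℝ (fderiv ℝ f) z).flip 1
      - Complex.I • (fderiv ℝ (fderiv ℝ f) z).flip Complex.I)) z := by
  have h := ((hasFDerivAt_fderiv_apply hf z 1).sub
    ((hasFDerivAt_fderiv_apply hf z Complex.I).const_mul Complex.I)).const_mul (2⁻¹ : ℂ)
  refine h.congr_of_eventuallyEq (.of_forall fun w => ?_)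
  simp [wd, div_eq_inv_mul]

theorem hasFDerivAt_wdb {f : ℂ → ℂ} (hf : ContDiff ℝ 2 f) (z : ℂ) :
    HasFDerivAt (wdb f) ((2⁻¹ : ℂ) • ((fderiv ℝ (fderiv ℝ f) z).flip 1
      + Complex.I • (fderiv ℝ (fderiv ℝ f) z).flip Complex.I)) z := by
  have h := ((hasFDerivAt_fderiv_apply hf z 1).add
    ((hasFDerivAt_fderiv_apply hf z Complex.I).const_mul Complex.I)).const_mul (2⁻¹ : ℂ)
  refine h.congr_of_eventuallyEq (.of_forall fun w => ?_)
  simp [wdb, div_eq_inv_mul]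

theorem wdb_wd_eq_wd_wdb {f : ℂ → ℂ} (hf : ContDiff ℝ 2 f) (z : ℂ) :
    wdb (wd f) z = wd (wdb f) z := by
  have hsymm : fderiv ℝ (fderiv ℝ f) z 1 Complex.I = fderiv ℝ (fderiv ℝ f) z Complex.I 1 :=
    (hf.contDiffAt.isSymmSndFDerivAt (by simp)).eq 1 Complex.I
  rw [wdb, wd, (hasFDerivAt_wd hf z).fderiv, (hasFDerivAt_wdb hf z).fderiv]
  simp only [_root_.smul_apply, _root_.add_apply, _root_.sub_apply,
    ContinuousLinearMap.flip_apply, smul_eq_mul, hsymm]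
  ring

/-- The curvature of `A_λ dz + B_λ dz̄` is diagonal and independent of `λ`. -/
theorem curvature_eq {u : ℂ → ℝ} (hu : ContDiff ℝ 2 u) {lam : ℂ} (hlam : lam ≠ 0) (z : ℂ) :
    mwd (fun w => matB u lam w) z - mwdb (fun w => matA u lam w) z
        + matA u lam z * matB u lam z - matB u lam z * matA u lam z
      = (wd (wdb (cx u)) z + (1/2) * Complex.sinh (2 * (u z : ℂ))) • !![-1, 0; 0, 1] := by
  have hc : ContDiff ℝ 2 (cx u) := Complex.ofRealCLM.contDiff.comp hu
  have hd : DifferentiableAt ℝ (cx u) z := hc.differentiable (by norm_num) z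
  have hwd : DifferentiableAt ℝ (wd (cx u)) z := (hasFDerivAt_wd hc z).differentiableAt
  have hwdb : DifferentiableAt ℝ (wdb (cx u)) z := (hasFDerivAt_wdb hc z).differentiableAt
  have hexp (c : ℂ) : DifferentiableAt ℝ (fun w => Complex.exp (c * cx u w)) z :=
    (hd.const_mul c).cexp
  have hA : mwdb (fun w => matA u lam w) z = ((1:ℂ)/2) •
      !![wd (wdb (cx u)) z, Complex.I * lam⁻¹ * (Complex.exp (u z) * wdb (cx u) z);
        -(Complex.I * (Complex.exp (-(u z)) * wdb (cx u) z)), -wd (wdb (cx u)) z] := by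
    have h1 := wdb_const_mul (1/2) hwd
    have h2 := wdb_const_mul (1/2 * (Complex.I * lam⁻¹)) (hexp 1)
    have h3 := wdb_const_mul (1/2 * Complex.I) (hexp (-1))
    have h4 := wdb_const_mul (-(1/2)) hwd
    rw [wdb_wd_eq_wd_wdb hc] at h1 h4
    rw [wdb_exp_const_mul _ hd] at h2 h3
    ext i j
    fin_cases i <;> fin_cases j
    · simpa [mwdb, matA, cx, mul_assoc] using h1
    · simpa [mwdb, matA, cx, mul_assoc] using h2
    · simpa [mwdb, matA, cx, mul_assoc] using h3
    · simpa [mwdb, matA, cx, mul_assoc] using h4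
  have hB : mwd (fun w => matB u lam w) z = ((1:ℂ)/2) •
      !![-wd (wdb (cx u)) z, -(Complex.I * (Complex.exp (-(u z)) * wd (cx u) z));
        Complex.I * lam * (Complex.exp (u z) * wd (cx u) z), wd (wdb (cx u)) z] := by
    have h1 := wd_const_mul (-(1/2)) hwdb
    have h2 := wd_const_mul (1/2 * Complex.I) (hexp (-1))
    have h3 := wd_const_mul (1/2 * (Complex.I * lam)) (hexp 1)
    have h4 := wd_const_mul (1/2) hwdb
    rw [wd_exp_const_mul _ hd] at h2 h3
    ext i j
    fin_cases i <;> fin_cases j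
    · simpa [mwd, matB, cx, mul_assoc] using h1
    · simpa [mwd, matB, cx, mul_assoc] using h2
    · simpa [mwd, matB, cx, mul_assoc] using h3
    · simpa [mwd, matB, cx, mul_assoc] using h4
  have hsinh : Complex.sinh (2 * (u z : ℂ))
      = (Complex.exp (u z) ^ 2 - Complex.exp (-(u z)) ^ 2) / 2 := by
    rw [Complex.sinh, ← Complex.exp_nat_mul, ← Complex.exp_nat_mul]
    push_cast
    ring_nf
  have hI : Complex.I ^ 2 = -1 := Complex.I_sq
  have hl : lam * lam⁻¹ = 1 := mul_inv_cancel₀ hlam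
  rw [hA, hB, hsinh]
  ext i j
  fin_cases i <;> fin_cases j <;>
    simp [matA, matB] <;> grind

/-- the zero-curvature equation for `α_λ = A_λ dz + B_λ dz̄` holds for
all `λ ≠ 0` iff `u` solves the sinh-Gordon equation. -/
theorem statement0 (u : ℂ → ℝ) (hu : ContDiff ℝ (⊤ : ℕ∞) u) :
    (∀ lam : ℂ, lam ≠ 0 → ∀ z : ℂ,
      mwd (fun w => matB u lam w) z - mwdb (fun w => matA u lam w) z
        + matA u lam z * matB u lam z - matB u lam z * matA u lam z = 0)
    ↔ SinhGordon u := by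
  have hu2 : ContDiff ℝ 2 u := contDiff_infty.1 hu 2
  constructor
  · intro h z
    have h11 := congrFun₂ (h 1 one_ne_zero z) 1 1
    rw [curvature_eq hu2 one_ne_zero] at h11
    simpa using h11
  · intro h lam hlam z
    rw [curvature_eq hu2 hlam, h z, zero_smul]
end
end

section
/- Let u : ℂ → ℝ be smooth, λ ∈ ℂ\{0}, let (ψ₁, ψ₂) solve system (Ψ_λ) and (φ₁, φ₂) solve system (Φ_λ). Then the function y = ψ₁φ₁ + ψ₂φ₂ is constant on ℂ, i.e. ∂y = 0 and ∂̄y = 0. -/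
noncomputable section

open Complex Matrix

theorem wd_add {f g : ℂ → ℂ} {z : ℂ} (hf : DifferentiableAt ℝ f z)
    (hg : DifferentiableAt ℝ g z) :
    wd (fun w => f w + g w) z = wd f z + wd g z := by
  simp only [wd, fderiv_fun_add hf hg, _root_.add_apply]
  ring

theorem wd_mul {f g : ℂ → ℂ} {z : ℂ} (hf : DifferentiableAt ℝ f z)
    (hg : DifferentiableAt ℝ g z) :
    wd (fun w => f w * g w) z = wd f z * g z + f z * wd g z := by
  simp only [wd, fderiv_fun_mul hf hg, _root_.add_apply, _root_.smul_apply, smul_eq_mul]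
  ring

theorem wdb_add {f g : ℂ → ℂ} {z : ℂ} (hf : DifferentiableAt ℝ f z)
    (hg : DifferentiableAt ℝ g z) :
    wdb (fun w => f w + g w) z = wdb f z + wdb g z := by
  simp only [wdb, fderiv_fun_add hf hg, _root_.add_apply]
  ring

theorem wdb_mul {f g : ℂ → ℂ} {z : ℂ} (hf : DifferentiableAt ℝ f z)
    (hg : DifferentiableAt ℝ g z) :
    wdb (fun w => f w * g w) z = wdb f z * g z + f z * wdb g z := by
  simp only [wdb, fderiv_fun_mul hf hg, _root_.add_apply, _root_.smul_apply, smul_eq_mul]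
  ring

/-- `y = ψ₁φ₁ + ψ₂φ₂` is constant. -/
theorem statement7 (u : ℂ → ℝ) (hu : ContDiff ℝ (⊤ : ℕ∞) u) (lam : ℂ) (hlam : lam ≠ 0)
    (p1 p2 f1 f2 : ℂ → ℂ) (hpsi : SolPsi u lam p1 p2) (hphi : SolPhi u lam f1 f2) :
    ∀ z, wd (fun w => p1 w * f1 w + p2 w * f2 w) z = 0 ∧
      wdb (fun w => p1 w * f1 w + p2 w * f2 w) z = 0 := by
  obtain ⟨hp1, hp2, dp1, dp2, bp1, bp2⟩ := hpsi
  obtain ⟨hf1, hf2, df1, df2, bf1, bf2⟩ := hphi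
  intro z
  have diff {g : ℂ → ℂ} (hg : ContDiff ℝ (⊤ : ℕ∞) g) : DifferentiableAt ℝ g z :=
    hg.differentiable (by simp) z
  constructor
  · rw [wd_add ((diff hp1).fun_mul (diff hf1)) ((diff hp2).fun_mul (diff hf2)),
      wd_mul (diff hp1) (diff hf1), wd_mul (diff hp2) (diff hf2), dp1, dp2, df1, df2]
    ring
  · rw [wdb_add ((diff hp1).fun_mul (diff hf1)) ((diff hp2).fun_mul (diff hf2)),
      wdb_mul (diff hp1) (diff hf1), wdb_mul (diff hp2) (diff hf2), bp1, bp2, bf1, bf2]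
    ring
end
end

section
/- Let u : ℂ → ℝ be smooth, λ ∈ ℂ\{0}, let (ψ₁, ψ₂) solve system (Ψ_λ) and (φ₁, φ₂) solve system (Φ_λ), and set ω = ψ₁φ₁ − ψ₂φ₂. Then ∂(e^{−u} ψ₁φ₂) = −(i/2) e^{−2u} ω and ∂̄(e^{−u} ψ₂φ₁) = (i/2) e^{−2u} ω hold identically. Equivalently, for any nonzero constant Q ∈ ℂ, the functions τ = i ψ₂φ₁/(e^{u} Q) and σ = −i ψ₁φ₂/(e^{u} Q̄) satisfy ∂̄τ = −e^{−2u} ω/(2Q) and ∂σ = −e^{−2u} ω/(2Q̄). -/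
noncomputable section

open Complex Matrix

theorem hasFDerivAt_exp_neg {f : ℂ → ℂ} {z : ℂ} (hf : DifferentiableAt ℝ f z) :
    HasFDerivAt (fun w => Complex.exp (-f w)) (Complex.exp (-f z) • -fderiv ℝ f z) z :=
  hf.hasFDerivAt.fun_neg.cexp

theorem wd_exp_neg {f : ℂ → ℂ} {z : ℂ} (hf : DifferentiableAt ℝ f z) :
    wd (fun w => Complex.exp (-f w)) z = -(Complex.exp (-f z) * wd f z) := by
  simp only [wd, (hasFDerivAt_exp_neg hf).fderiv, _root_.smul_apply,
    _root_.neg_apply, smul_eq_mul]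
  ring

theorem wdb_exp_neg {f : ℂ → ℂ} {z : ℂ} (hf : DifferentiableAt ℝ f z) :
    wdb (fun w => Complex.exp (-f w)) z = -(Complex.exp (-f z) * wdb f z) := by
  simp only [wdb, (hasFDerivAt_exp_neg hf).fderiv, _root_.smul_apply,
    _root_.neg_apply, smul_eq_mul]
  ring

/-- the equations for the tangential components `τ` and `σ`
supplementing the Jacobi field `ω = ψ₁φ₁ - ψ₂φ₂`. -/
theorem statement9 (u : ℂ → ℝ) (hu : ContDiff ℝ (⊤ : ℕ∞) u) (lam : ℂ) (hlam : lam ≠ 0)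
    (p1 p2 f1 f2 : ℂ → ℂ) (hpsi : SolPsi u lam p1 p2) (hphi : SolPhi u lam f1 f2) :
    (∀ z, wd (fun w => Complex.exp (-(u w : ℂ)) * p1 w * f2 w) z
        = -(Complex.I / 2) * Complex.exp (-(2 * (u z : ℂ)))
            * (p1 z * f1 z - p2 z * f2 z)) ∧
    (∀ z, wdb (fun w => Complex.exp (-(u w : ℂ)) * p2 w * f1 w) z
        = (Complex.I / 2) * Complex.exp (-(2 * (u z : ℂ)))
            * (p1 z * f1 z - p2 z * f2 z)) ∧
    (∀ Q : ℂ, Q ≠ 0 →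
      (∀ z, wdb (fun w => Complex.I * p2 w * f1 w / (Complex.exp ((u w : ℂ)) * Q)) z
          = -(Complex.exp (-(2 * (u z : ℂ))) * (p1 z * f1 z - p2 z * f2 z)) / (2 * Q)) ∧
      (∀ z, wd (fun w => -(Complex.I * p1 w * f2 w)
            / (Complex.exp ((u w : ℂ)) * (starRingEnd ℂ) Q)) z
          = -(Complex.exp (-(2 * (u z : ℂ))) * (p1 z * f1 z - p2 z * f2 z))
              / (2 * (starRingEnd ℂ) Q))) := by
  obtain ⟨hp1, hp2, hp1z, -, -, hp2b⟩ := hpsi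
  obtain ⟨hf1, hf2, -, hf2z, hf1b, -⟩ := hphi
  have dp1 : Differentiable ℝ p1 := hp1.differentiable (by simp)
  have dp2 : Differentiable ℝ p2 := hp2.differentiable (by simp)
  have df1 : Differentiable ℝ f1 := hf1.differentiable (by simp)
  have df2 : Differentiable ℝ f2 := hf2.differentiable (by simp)
  have du : Differentiable ℝ (cx u) :=
    Complex.ofRealCLM.differentiable.comp (hu.differentiable (by simp))
  have de : Differentiable ℝ (fun w => Complex.exp (-(u w : ℂ))) :=
    fun z => (hasFDerivAt_exp_neg (du z)).differentiableAt
  have exp_sq (z : ℂ) : Complex.exp (-(2 * (u z : ℂ))) = Complex.exp (-(u z : ℂ)) ^ 2 := by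
    rw [← Complex.exp_nat_mul]
    push_cast
    ring_nf
  have hσ (z : ℂ) : wd (fun w => Complex.exp (-(u w : ℂ)) * p1 w * f2 w) z
      = -(Complex.I / 2) * Complex.exp (-(2 * (u z : ℂ)))
          * (p1 z * f1 z - p2 z * f2 z) := by
    have he : wd (fun w => Complex.exp (-(u w : ℂ))) z
        = -(Complex.exp (-(u z : ℂ)) * wd (cx u) z) := wd_exp_neg (du z)
    rw [wd_mul ((de z).fun_mul (dp1 z)) (df2 z), wd_mul (de z) (dp1 z), he, hp1z, hf2z, exp_sq]
    ring
  have hτ (z : ℂ) : wdb (fun w => Complex.exp (-(u w : ℂ)) * p2 w * f1 w) z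
      = (Complex.I / 2) * Complex.exp (-(2 * (u z : ℂ)))
          * (p1 z * f1 z - p2 z * f2 z) := by
    have he : wdb (fun w => Complex.exp (-(u w : ℂ))) z
        = -(Complex.exp (-(u z : ℂ)) * wdb (cx u) z) := wdb_exp_neg (du z)
    rw [wdb_mul ((de z).fun_mul (dp2 z)) (df1 z), wdb_mul (de z) (dp2 z), he, hp2b, hf1b, exp_sq]
    ring
  refine ⟨hσ, hτ, fun Q _ => ⟨fun z => ?_, fun z => ?_⟩⟩
  · have h : (fun w => Complex.I * p2 w * f1 w / (Complex.exp ((u w : ℂ)) * Q))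
        = fun w => Complex.I / Q * (Complex.exp (-(u w : ℂ)) * p2 w * f1 w) := by
      funext w
      rw [Complex.exp_neg]
      ring
    rw [h, wdb_const_mul _ (((de z).fun_mul (dp2 z)).fun_mul (df1 z)), hτ]
    linear_combination (Complex.exp (-(2 * (u z : ℂ))) * (p1 z * f1 z - p2 z * f2 z)) / (2 * Q)
      * Complex.I_sq
  · have h : (fun w => -(Complex.I * p1 w * f2 w)
          / (Complex.exp ((u w : ℂ)) * (starRingEnd ℂ) Q))
        = fun w => -Complex.I / (starRingEnd ℂ) Q
          * (Complex.exp (-(u w : ℂ)) * p1 w * f2 w) := by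
      funext w
      rw [Complex.exp_neg]
      ring
    rw [h, wd_const_mul _ (((de z).fun_mul (dp1 z)).fun_mul (df2 z)), hσ]
    linear_combination (Complex.exp (-(2 * (u z : ℂ))) * (p1 z * f1 z - p2 z * f2 z))
      / (2 * (starRingEnd ℂ) Q) * Complex.I_sq
end
end

section
/- Let u : ℂ → ℝ be smooth, λ ∈ ℂ\{0}, let (ψ₁, ψ₂) solve system (Ψ_λ) and (φ₁, φ₂) solve system (Φ_λ). Set ω = ψ₁φ₁ − ψ₂φ₂, y = ψ₁φ₁ + ψ₂φ₂, and φ = −i e^{−u} ψ₂φ₁ − i λ⁻¹ e^{u} ψ₁φ₂. Then (∂ω)² − φ² = λ⁻¹ (y² − ω²) holds identically on ℂ. -/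
noncomputable section

open Complex Matrix

theorem wd_sub {f g : ℂ → ℂ} {z : ℂ} (hf : DifferentiableAt ℝ f z)
    (hg : DifferentiableAt ℝ g z) : wd (fun w => f w - g w) z = wd f z - wd g z := by
  simp only [wd, fderiv_fun_sub hf hg, _root_.sub_apply]
  ring

/-- the identity `(∂ω)² - φ² = λ⁻¹(y² - ω²)`. -/
theorem statement11 (u : ℂ → ℝ) (hu : ContDiff ℝ (⊤ : ℕ∞) u) (lam : ℂ) (hlam : lam ≠ 0)
    (p1 p2 f1 f2 : ℂ → ℂ) (hpsi : SolPsi u lam p1 p2) (hphi : SolPhi u lam f1 f2) :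
    ∀ z, (wd (fun w => p1 w * f1 w - p2 w * f2 w) z) ^ 2
        - (-(Complex.I) * Complex.exp (-(u z : ℂ)) * p2 z * f1 z
            - Complex.I * lam⁻¹ * Complex.exp ((u z : ℂ)) * p1 z * f2 z) ^ 2
      = lam⁻¹ * ((p1 z * f1 z + p2 z * f2 z) ^ 2
          - (p1 z * f1 z - p2 z * f2 z) ^ 2) := by
  obtain ⟨hp1, hp2, dp1, dp2, -, -⟩ := hpsi
  obtain ⟨hf1, hf2, df1, df2, -, -⟩ := hphi
  intro z
  have top_ne_zero : ((⊤ : ℕ∞) : WithTop ℕ∞) ≠ 0 := by simp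
  have hp1 := hp1.differentiable top_ne_zero z
  have hp2 := hp2.differentiable top_ne_zero z
  have hf1 := hf1.differentiable top_ne_zero z
  have hf2 := hf2.differentiable top_ne_zero z
  have hexp : Complex.exp (-(u z : ℂ)) * Complex.exp (u z : ℂ) = 1 := by
    rw [← Complex.exp_add, neg_add_cancel, Complex.exp_zero]
  rw [wd_sub (hp1.fun_mul hf1) (hp2.fun_mul hf2), wd_mul hp1 hf1, wd_mul hp2 hf2,
    dp1, dp2, df1, df2]
  linear_combination
    (-4 * Complex.I ^ 2 * lam⁻¹ * p1 z * p2 z * f1 z * f2 z) * hexp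
      - 4 * lam⁻¹ * p1 z * p2 z * f1 z * f2 z * Complex.I_sq
end
end

section
/- Let u : ℂ → ℝ be smooth, a ∈ ℂ\{0}, let (ψ₁, ψ₂) solve system (Ψ_a) and (φ₁, φ₂) solve system (Φ_a), and set ξᵢⱼ = ψᵢφⱼ and u̇ = ξ₁₁ − ξ₂₂. For λ ∈ ℂ\{0, a} define the matrix-valued function X = (1/(λ−a)) [[(λ+a)ξ₁₁, 2λξ₁₂], [2aξ₂₁, (λ+a)ξ₂₂]], and put A_λ = (1/2)[[∂u, i e^{−u}], [i λ⁻¹ e^{u}, −∂u]], B_λ = (1/2)[[−∂̄u, i λ e^{u}], [i e^{−u}, ∂̄u]], Ȧ = (1/2)[[∂u̇, −i u̇ e^{−u}], [i u̇ λ⁻¹ e^{u}, −∂u̇]], Ḃ = (1/2)[[−∂̄u̇, i u̇ λ e^{u}], [−i u̇ e^{−u}, ∂̄u̇]]. Then 2∂X + [X, 2A_λ] = 2Ȧ and 2∂̄X + [X, 2B_λ] = 2Ḃ hold identically on ℂ. Consequently, for any solution ψ of system (Ψ_λ), the function ψ̇ = Xψ satisfies ∂ψ̇ = A_λ ψ̇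 + Ȧ ψ and ∂̄ψ̇ = B_λ ψ̇ + Ḃ ψ. -/
noncomputable section

open Complex Matrix

/-- The coefficient matrix `A_λ` of the system `(Ψ_λ)`. -/
def A16 (u : ℂ → ℝ) (lam : ℂ) (z : ℂ) : Matrix (Fin 2) (Fin 2) ℂ :=
  ((1:ℂ)/2) • !![wd (cx u) z, Complex.I * Complex.exp (-(u z : ℂ));
    Complex.I * lam⁻¹ * Complex.exp ((u z : ℂ)), -(wd (cx u) z)]

/-- The coefficient matrix `B_λ` of the system `(Ψ_λ)`. -/
def B16 (u : ℂ → ℝ) (lam : ℂ) (z : ℂ) : Matrix (Fin 2) (Fin 2) ℂ :=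
  ((1:ℂ)/2) • !![-(wdb (cx u) z), Complex.I * lam * Complex.exp ((u z : ℂ));
    Complex.I * Complex.exp (-(u z : ℂ)), wdb (cx u) z]

/-- The matrix `X` of the variation of the Baker-Akhiezer function. -/
def X16 (lam a : ℂ) (p1 p2 f1 f2 : ℂ → ℂ) (z : ℂ) : Matrix (Fin 2) (Fin 2) ℂ :=
  ((lam - a)⁻¹) • !![(lam + a) * (p1 z * f1 z), 2 * lam * (p1 z * f2 z);
    2 * a * (p2 z * f1 z), (lam + a) * (p2 z * f2 z)]

/-- The matrix `Ȧ` for `u̇ = ξ₁₁ - ξ₂₂`. -/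
def Adot16 (u : ℂ → ℝ) (lam : ℂ) (p1 p2 f1 f2 : ℂ → ℂ) (z : ℂ) :
    Matrix (Fin 2) (Fin 2) ℂ :=
  ((1:ℂ)/2) • !![wd (fun w => p1 w * f1 w - p2 w * f2 w) z,
      -(Complex.I) * (p1 z * f1 z - p2 z * f2 z) * Complex.exp (-(u z : ℂ));
    Complex.I * (p1 z * f1 z - p2 z * f2 z) * lam⁻¹ * Complex.exp ((u z : ℂ)),
      -(wd (fun w => p1 w * f1 w - p2 w * f2 w) z)]

/-- The matrix `Ḃ` for `u̇ = ξ₁₁ - ξ₂₂`. -/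
def Bdot16 (u : ℂ → ℝ) (lam : ℂ) (p1 p2 f1 f2 : ℂ → ℂ) (z : ℂ) :
    Matrix (Fin 2) (Fin 2) ℂ :=
  ((1:ℂ)/2) • !![-(wdb (fun w => p1 w * f1 w - p2 w * f2 w) z),
      Complex.I * (p1 z * f1 z - p2 z * f2 z) * lam * Complex.exp ((u z : ℂ));
    -(Complex.I) * (p1 z * f1 z - p2 z * f2 z) * Complex.exp (-(u z : ℂ)),
      wdb (fun w => p1 w * f1 w - p2 w * f2 w) z]

theorem vwd_mulVec {F : ℂ → Matrix (Fin 2) (Fin 2) ℂ} {v : ℂ → Fin 2 → ℂ} {z : ℂ}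
    (hF : ∀ i j, DifferentiableAt ℝ (fun w => F w i j) z)
    (hv : ∀ i, DifferentiableAt ℝ (fun w => v w i) z) :
    vwd (fun w => F w *ᵥ v w) z = mwd F z *ᵥ v z + F z *ᵥ vwd v z := by
  funext i
  simp only [vwd, mwd, mulVec, dotProduct, Fin.sum_univ_two, Pi.add_apply, of_apply]
  rw [wd_add ((hF i 0).fun_mul (hv 0)) ((hF i 1).fun_mul (hv 1)), wd_mul (hF i 0) (hv 0),
    wd_mul (hF i 1) (hv 1)]
  ring

theorem wdb_sub {f g : ℂ → ℂ} {z : ℂ} (hf : DifferentiableAt ℝ f z)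
    (hg : DifferentiableAt ℝ g z) :
    wdb (fun w => f w - g w) z = wdb f z - wdb g z := by
  simp only [wdb, fderiv_fun_sub hf hg, _root_.sub_apply]
  ring

theorem vwdb_mulVec {F : ℂ → Matrix (Fin 2) (Fin 2) ℂ} {v : ℂ → Fin 2 → ℂ} {z : ℂ}
    (hF : ∀ i j, DifferentiableAt ℝ (fun w => F w i j) z)
    (hv : ∀ i, DifferentiableAt ℝ (fun w => v w i) z) :
    vwdb (fun w => F w *ᵥ v w) z = mwdb F z *ᵥ v z + F z *ᵥ vwdb v z := by
  funext i
  simp only [vwdb, mwdb, mulVec, dotProduct, Fin.sum_univ_two, Pi.add_apply, of_apply]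
  rw [wdb_add ((hF i 0).fun_mul (hv 0)) ((hF i 1).fun_mul (hv 1)), wdb_mul (hF i 0) (hv 0),
    wdb_mul (hF i 1) (hv 1)]
  ring

theorem X16_differentiable (lam a : ℂ) {p1 p2 f1 f2 : ℂ → ℂ} (hp1 : Differentiable ℝ p1)
    (hp2 : Differentiable ℝ p2) (hf1 : Differentiable ℝ f1) (hf2 : Differentiable ℝ f2)
    (i j : Fin 2) : Differentiable ℝ fun w => X16 lam a p1 p2 f1 f2 w i j := by
  fin_cases i <;> fin_cases j <;> simp [X16] <;> fun_prop

theorem mwd_X16_add_commutator {u : ℂ → ℝ} {lam a : ℂ} {p1 p2 f1 f2 : ℂ → ℂ} (ha : a ≠ 0)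
    (hlam : lam ≠ 0) (hlama : lam ≠ a) (hpsi : SolPsi u a p1 p2) (hphi : SolPhi u a f1 f2)
    (z : ℂ) :
    (2 : ℂ) • mwd (fun w => X16 lam a p1 p2 f1 f2 w) z
        + (X16 lam a p1 p2 f1 f2 z * ((2 : ℂ) • A16 u lam z)
            - ((2 : ℂ) • A16 u lam z) * X16 lam a p1 p2 f1 f2 z)
      = (2 : ℂ) • Adot16 u lam p1 p2 f1 f2 z := by
  obtain ⟨hp1, hp2, hp1z, hp2z, hp1b, hp2b⟩ := hpsi
  obtain ⟨hf1, hf2, hf1z, hf2z, hf1b, hf2b⟩ := hphi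
  have dp1 := (hp1.differentiable (by simp)) z
  have dp2 := (hp2.differentiable (by simp)) z
  have df1 := (hf1.differentiable (by simp)) z
  have df2 := (hf2.differentiable (by simp)) z
  have hne : lam - a ≠ 0 := sub_ne_zero.mpr hlama
  have d11 := dp1.fun_mul df1
  have d12 := dp1.fun_mul df2
  have d21 := dp2.fun_mul df1
  have d22 := dp2.fun_mul df2
  ext i j
  fin_cases i <;> fin_cases j <;>
    simp [mwd, X16, A16, Adot16,
      wd_const_mul _ (d11.const_mul _), wd_const_mul _ (d12.const_mul _),
      wd_const_mul _ (d21.const_mul _), wd_const_mul _ (d22.const_mul _),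
      wd_const_mul _ d11, wd_const_mul _ d12, wd_const_mul _ d21, wd_const_mul _ d22,
      wd_sub d11 d22, wd_mul dp1 df1, wd_mul dp1 df2, wd_mul dp2 df1, wd_mul dp2 df2,
      hp1z, hp2z, hf1z, hf2z, -Complex.ofReal_exp] <;>
    generalize Complex.exp (-(u z : ℂ)) = E <;>
    field_simp <;>
    ring

theorem mwdb_X16_add_commutator {u : ℂ → ℝ} {lam a : ℂ} {p1 p2 f1 f2 : ℂ → ℂ}
    (hlam : lam ≠ 0) (hlama : lam ≠ a) (hpsi : SolPsi u a p1 p2) (hphi : SolPhi u a f1 f2)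
    (z : ℂ) :
    (2 : ℂ) • mwdb (fun w => X16 lam a p1 p2 f1 f2 w) z
        + (X16 lam a p1 p2 f1 f2 z * ((2 : ℂ) • B16 u lam z)
            - ((2 : ℂ) • B16 u lam z) * X16 lam a p1 p2 f1 f2 z)
      = (2 : ℂ) • Bdot16 u lam p1 p2 f1 f2 z := by
  obtain ⟨hp1, hp2, hp1z, hp2z, hp1b, hp2b⟩ := hpsi
  obtain ⟨hf1, hf2, hf1z, hf2z, hf1b, hf2b⟩ := hphi
  have dp1 := (hp1.differentiable (by simp)) z
  have dp2 := (hp2.differentiable (by simp)) z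
  have df1 := (hf1.differentiable (by simp)) z
  have df2 := (hf2.differentiable (by simp)) z
  have hne : lam - a ≠ 0 := sub_ne_zero.mpr hlama
  have d11 := dp1.fun_mul df1
  have d12 := dp1.fun_mul df2
  have d21 := dp2.fun_mul df1
  have d22 := dp2.fun_mul df2
  ext i j
  fin_cases i <;> fin_cases j <;>
    simp [mwdb, X16, B16, Bdot16,
      wdb_const_mul _ (d11.const_mul _), wdb_const_mul _ (d12.const_mul _),
      wdb_const_mul _ (d21.const_mul _), wdb_const_mul _ (d22.const_mul _),
      wdb_const_mul _ d11, wdb_const_mul _ d12, wdb_const_mul _ d21, wdb_const_mul _ d22,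
      wdb_sub d11 d22, wdb_mul dp1 df1, wdb_mul dp1 df2, wdb_mul dp2 df1, wdb_mul dp2 df2,
      hp1b, hp2b, hf1b, hf2b, -Complex.ofReal_exp] <;>
    generalize Complex.exp (-(u z : ℂ)) = E <;>
    field_simp <;>
    ring

theorem derivative_mulVec_of_commutator {X D A Adot : Matrix (Fin 2) (Fin 2) ℂ}
    (h : (2 : ℂ) • D + (X * ((2 : ℂ) • A) - ((2 : ℂ) • A) * X) = (2 : ℂ) • Adot)
    (v : Fin 2 → ℂ) : D *ᵥ v + X *ᵥ (A *ᵥ v) = A *ᵥ (X *ᵥ v) + Adot *ᵥ v := by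
  have hD : D + X * A = A * X + Adot := by
    rw [Matrix.mul_smul, Matrix.smul_mul, ← smul_sub, ← smul_add] at h
    rw [← smul_right_injective _ (two_ne_zero : (2 : ℂ) ≠ 0) h]
    abel
  rw [mulVec_mulVec, mulVec_mulVec, ← add_mulVec, ← add_mulVec, hD]

/-- variation of the Baker-Akhiezer function. -/
theorem statement16 (u : ℂ → ℝ) (hu : ContDiff ℝ (⊤ : ℕ∞) u) (a : ℂ) (ha : a ≠ 0)
    (p1 p2 f1 f2 : ℂ → ℂ) (hpsi : SolPsi u a p1 p2) (hphi : SolPhi u a f1 f2)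
    (lam : ℂ) (hlam : lam ≠ 0) (hlama : lam ≠ a) :
    (∀ z, (2:ℂ) • mwd (fun w => X16 lam a p1 p2 f1 f2 w) z
        + (X16 lam a p1 p2 f1 f2 z * ((2:ℂ) • A16 u lam z)
            - ((2:ℂ) • A16 u lam z) * X16 lam a p1 p2 f1 f2 z)
        = (2:ℂ) • Adot16 u lam p1 p2 f1 f2 z) ∧
    (∀ z, (2:ℂ) • mwdb (fun w => X16 lam a p1 p2 f1 f2 w) z
        + (X16 lam a p1 p2 f1 f2 z * ((2:ℂ) • B16 u lam z)
            - ((2:ℂ) • B16 u lam z) * X16 lam a p1 p2 f1 f2 z)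
        = (2:ℂ) • Bdot16 u lam p1 p2 f1 f2 z) ∧
    (∀ ψ : ℂ → Fin 2 → ℂ, (∀ i, ContDiff ℝ (⊤ : ℕ∞) fun z => ψ z i) →
      (∀ z, vwd ψ z = A16 u lam z *ᵥ ψ z) →
      (∀ z, vwdb ψ z = B16 u lam z *ᵥ ψ z) →
      (∀ z, vwd (fun w => X16 lam a p1 p2 f1 f2 w *ᵥ ψ w) z
          = A16 u lam z *ᵥ (X16 lam a p1 p2 f1 f2 z *ᵥ ψ z)
            + Adot16 u lam p1 p2 f1 f2 z *ᵥ ψ z) ∧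
      (∀ z, vwdb (fun w => X16 lam a p1 p2 f1 f2 w *ᵥ ψ w) z
          = B16 u lam z *ᵥ (X16 lam a p1 p2 f1 f2 z *ᵥ ψ z)
            + Bdot16 u lam p1 p2 f1 f2 z *ᵥ ψ z)) := by
  have hA := mwd_X16_add_commutator ha hlam hlama hpsi hphi
  have hB := mwdb_X16_add_commutator hlam hlama hpsi hphi
  have hX := X16_differentiable lam a (hpsi.1.differentiable (by simp))
    (hpsi.2.1.differentiable (by simp)) (hphi.1.differentiable (by simp))
    (hphi.2.1.differentiable (by simp))
  refine ⟨hA, hB, fun ψ hψ hψA hψB => ⟨fun z => ?_, fun z => ?_⟩⟩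
  · rw [vwd_mulVec (fun i j => hX i j z) (fun i => (hψ i).differentiable (by simp) z), hψA z]
    exact derivative_mulVec_of_commutator (hA z) (ψ z)
  · rw [vwdb_mulVec (fun i j => hX i j z) (fun i => (hψ i).differentiable (by simp) z), hψB z]
    exact derivative_mulVec_of_commutator (hB z) (ψ z)
end
end

section
/- Let u : ℂ → ℝ be smooth, λ ∈ ℂ\{0}, let μ ∈ ℂ with μ² = λ, and let (ψ₁, ψ₂) solve system (Ψ_λ). Define ψ̃₁ = μ⁻¹ e^{u/2} ψ₁ and ψ̃₂ = e^{−u/2} ψ₂. Then ∂ψ̃₁ = ∂u·ψ̃₁ + (i/2) μ⁻¹ ψ̃₂, ∂ψ̃₂ = (i/2) μ⁻¹ ψ̃₁ − ∂u·ψ̃₂, ∂̄ψ̃₁ = (i/2) μ e^{2u} ψ̃₂, and ∂̄ψ̃₂ = (i/2) μ e^{−2u} ψ̃₁ hold identically on ℂ. -/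
noncomputable section

open Complex Matrix

/-- Real Fréchet derivative of `c * exp (a u) * p`. -/
theorem fderiv_const_mul_exp_mul_mul {v p : ℂ → ℂ} {z : ℂ} (hv : DifferentiableAt ℝ v z)
    (hp : DifferentiableAt ℝ p z) (c a h : ℂ) :
    fderiv ℝ (fun w => c * exp (a * v w) * p w) z h
      = c * exp (a * v z) * (a * fderiv ℝ v z h * p z + fderiv ℝ p z h) := by
  have H := (((hv.hasFDerivAt.const_mul a).cexp.const_mul c).mul hp.hasFDerivAt).fderiv
  have H' := congrArg (fun L : ℂ →L[ℝ] ℂ => L h) H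
  refine Eq.trans H' ?_
  simp
  ring

theorem wd_const_mul_exp_mul_mul {v p : ℂ → ℂ} {z : ℂ} (hv : DifferentiableAt ℝ v z)
    (hp : DifferentiableAt ℝ p z) (c a : ℂ) :
    wd (fun w => c * exp (a * v w) * p w) z
      = c * exp (a * v z) * (a * wd v z * p z + wd p z) := by
  simp only [wd, fderiv_const_mul_exp_mul_mul hv hp]
  ring

theorem wdb_const_mul_exp_mul_mul {v p : ℂ → ℂ} {z : ℂ} (hv : DifferentiableAt ℝ v z)
    (hp : DifferentiableAt ℝ p z) (c a : ℂ) :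
    wdb (fun w => c * exp (a * v w) * p w) z
      = c * exp (a * v z) * (a * wdb v z * p z + wdb p z) := by
  simp only [wdb, fderiv_const_mul_exp_mul_mul hv hp]
  ring

theorem differentiable_cx {u : ℂ → ℝ} (hu : Differentiable ℝ u) : Differentiable ℝ (cx u) :=
  ofRealCLM.differentiable.comp hu

/-- the gauge transformation `ψ̃₁ = μ⁻¹e^{u/2}ψ₁`, `ψ̃₂ = e^{-u/2}ψ₂`. -/
theorem statement17 (u : ℂ → ℝ) (hu : ContDiff ℝ (⊤ : ℕ∞) u) (lam : ℂ) (hlam : lam ≠ 0)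
    (mu : ℂ) (hmu : mu ^ 2 = lam)
    (p1 p2 : ℂ → ℂ) (hpsi : SolPsi u lam p1 p2) :
    (∀ z, wd (fun w => mu⁻¹ * Complex.exp ((u w : ℂ) / 2) * p1 w) z
        = wd (cx u) z * (mu⁻¹ * Complex.exp ((u z : ℂ) / 2) * p1 z)
          + (Complex.I / 2) * mu⁻¹ * (Complex.exp (-((u z : ℂ) / 2)) * p2 z)) ∧
    (∀ z, wd (fun w => Complex.exp (-((u w : ℂ) / 2)) * p2 w) z
        = (Complex.I / 2) * mu⁻¹ * (mu⁻¹ * Complex.exp ((u z : ℂ) / 2) * p1 z)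
          - wd (cx u) z * (Complex.exp (-((u z : ℂ) / 2)) * p2 z)) ∧
    (∀ z, wdb (fun w => mu⁻¹ * Complex.exp ((u w : ℂ) / 2) * p1 w) z
        = (Complex.I / 2) * mu * Complex.exp (2 * (u z : ℂ))
            * (Complex.exp (-((u z : ℂ) / 2)) * p2 z)) ∧
    (∀ z, wdb (fun w => Complex.exp (-((u w : ℂ) / 2)) * p2 w) z
        = (Complex.I / 2) * mu * Complex.exp (-(2 * (u z : ℂ)))
            * (mu⁻¹ * Complex.exp ((u z : ℂ) / 2) * p1 z)) := by
  obtain ⟨hp1, hp2, h1, h2, h3, h4⟩ := hpsi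
  have hmu0 : mu ≠ 0 := by
    rintro rfl
    exact hlam (by simpa using hmu.symm)
  have hv := differentiable_cx (hu.differentiable (by simp))
  have hd1 : Differentiable ℝ p1 := hp1.differentiable (by simp)
  have hd2 : Differentiable ℝ p2 := hp2.differentiable (by simp)
  have e1 : (fun w => mu⁻¹ * exp ((u w : ℂ) / 2) * p1 w)
      = fun w => mu⁻¹ * exp ((1 / 2) * cx u w) * p1 w := by
    funext w
    rw [cx, one_div_mul_eq_div]
  have e2 : (fun w => exp (-((u w : ℂ) / 2)) * p2 w)
      = fun w => 1 * exp ((-1 / 2) * cx u w) * p2 w := by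
    funext w
    rw [cx, one_mul, neg_div, neg_mul, one_div_mul_eq_div]
  have hexp (z : ℂ) : exp ((1 / 2) * cx u z) = exp ((u z : ℂ) / 2) := by
    rw [cx, one_div_mul_eq_div]
  have hexp_neg (z : ℂ) : exp ((-1 / 2) * cx u z) = (exp ((u z : ℂ) / 2))⁻¹ := by
    rw [cx, ← exp_neg, neg_div, neg_mul, one_div_mul_eq_div]
  have hexp_sq (z : ℂ) : exp (u z : ℂ) = exp ((u z : ℂ) / 2) ^ 2 := by
    rw [← exp_nat_mul]
    congr 1
    push_cast
    ring
  have hexp_four (z : ℂ) : exp (2 * (u z : ℂ)) = exp ((u z : ℂ) / 2) ^ 4 := by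
    rw [← exp_nat_mul]
    congr 1
    push_cast
    ring
  have hne (z : ℂ) : exp ((u z : ℂ) / 2) ≠ 0 := exp_ne_zero _
  subst hmu
  refine ⟨fun z => ?_, fun z => ?_, fun z => ?_, fun z => ?_⟩
  · rw [e1, wd_const_mul_exp_mul_mul (hv z) (hd1 z), h1, hexp, exp_neg, exp_neg, hexp_sq]
    field_simp [hne z]
    ring
  · rw [e2, wd_const_mul_exp_mul_mul (hv z) (hd2 z), h2, hexp_neg, exp_neg, hexp_sq]
    field_simp [hne z]
    ring
  · rw [e1, wdb_const_mul_exp_mul_mul (hv z) (hd1 z), h3, hexp, exp_neg, hexp_sq, hexp_four]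
    field_simp [hne z]
    ring
  · rw [e2, wdb_const_mul_exp_mul_mul (hv z) (hd2 z), h4, hexp_neg, exp_neg, exp_neg, hexp_sq,
      hexp_four]
    field_simp [hne z]
    ring
end
end
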